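/- Let R be a left Noetherian ring and let (𝒯,ℱ) be a torsion pair in R-Mod. Then (𝒯,ℱ) is tCG if and only if (𝒯,ℱ) is of finite type. -/

import Mathlib

open CategoryTheory Limits DirectSum

universe w u

variable (R : Type u) [Ring R]

/-- A torsion pair `(T, F)` in the category of left `R`-modules: both classes are closed
under isomorphism, all homomorphisms from `T` to `F` vanish, and every module has a
torsion submodule in `T` with torsion-free quotient in `F`. -/
structure ModTorsionPair (T F : ModuleCat.{u} R → Prop) : Prop where
  iso_closed_torsion : ∀ {M N : ModuleCat.{u} R}, (M ≅ N) → T M → T N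
  iso_closed_torsionfree : ∀ {M N : ModuleCat.{u} R}, (M ≅ N) → F M → F N
  hom_eq_zero : ∀ {M N : ModuleCat.{u} R}, T M → F N → ∀ f : M →ₗ[R] N, f = 0
  exists_torsion_submodule : ∀ M : ModuleCat.{u} R, ∃ t : Submodule R M,
    T (ModuleCat.of R t) ∧ F (ModuleCat.of R (M ⧸ t))

/-- The torsion pair `(T, F)` is tCG: there is a set of finitely presented modules in
the torsion class `T` whose simultaneous `Hom`-vanishing cuts out exactly the
torsion-free class `F`. -/
def IsTCGTorsionPair (T F : ModuleCat.{u} R → Prop) : Prop :=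
  ∃ (Λ : Type u) (Tfam : Λ → ModuleCat.{u} R),
    (∀ l, Module.FinitePresentation R (Tfam l)) ∧ (∀ l, T (Tfam l)) ∧
    ∀ M : ModuleCat.{u} R, F M ↔ ∀ (l : Λ) (f : Tfam l →ₗ[R] M), f = 0

/-- A class of modules is closed under direct limits (filtered colimits). -/
def ClosedUnderDirectLimits (F : ModuleCat.{u} R → Prop) : Prop :=
  ∀ (J : Type u) [SmallCategory J] [IsFiltered J] (D : J ⥤ ModuleCat.{u} R)
    (c : Cocone D), IsColimit c → (∀ j, F (D.obj j)) → F c.pt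

section

variable {R}
variable {J : Type u} [SmallCategory J] [IsFiltered J] {D : J ⥤ ModuleCat.{u} R}
  {c : Cocone D}

/-- Finitely many elements of a stage that vanish in a filtered colimit vanish at a later stage. -/
theorem exists_map_eq_zero_of_finset (hc : IsColimit c) {j : J} (S : Finset (D.obj j))
    (hS : ∀ x ∈ S, c.ι.app j x = 0) : ∃ (k : J) (a : j ⟶ k), ∀ x ∈ S, D.map a x = 0 := by
  classical
  induction S using Finset.induction_on with
  | empty => exact ⟨j, 𝟙 j, by simp⟩
  | insert y S _ ih =>
    obtain ⟨k, a, ha⟩ := ih fun x hx => hS x (Finset.mem_insert_of_mem hx)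
    have hy : c.ι.app j y = c.ι.app j 0 := by
      rw [hS y (Finset.mem_insert_self y S), map_zero]
    obtain ⟨l, p, q, hpq⟩ := Concrete.isColimit_exists_of_rep_eq D hc y 0 hy
    rw [map_zero] at hpq
    obtain ⟨m, b, d, hbd⟩ := IsFiltered.span a p
    refine ⟨m, a ≫ b, fun x hx => ?_⟩
    rcases Finset.mem_insert.mp hx with rfl | hx
    · rw [hbd, D.map_comp, ConcreteCategory.comp_apply, hpq, map_zero]
    · rw [D.map_comp, ConcreteCategory.comp_apply, ha x hx, map_zero]

/-- A finite family of elements of a filtered colimit comes from a single stage. -/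
theorem exists_finite_family_rep (hc : IsColimit c) {ι : Type*} [Finite ι] (v : ι → c.pt) :
    ∃ (j : J) (x : ι → D.obj j), ∀ i, c.ι.app j (x i) = v i := by
  classical
  have := Fintype.ofFinite ι
  choose j x hx using fun i => Concrete.isColimit_exists_rep D hc (v i)
  obtain ⟨k, hk⟩ := IsFiltered.sup_objs_exists (Finset.univ.image j)
  have a : ∀ i, j i ⟶ k := fun i => (hk (Finset.mem_image_of_mem j (Finset.mem_univ i))).some
  refine ⟨k, fun i => D.map (a i) (x i), fun i => ?_⟩
  rw [← hx i, ← ConcreteCategory.comp_apply, c.w]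

/-- A homomorphism from a finitely presented module to a filtered colimit factors through a
stage. -/
theorem exists_factorization_of_finitePresentation (hc : IsColimit c) {P : Type*}
    [AddCommGroup P] [Module R P] [Module.FinitePresentation R P] (f : P →ₗ[R] c.pt) :
    ∃ (j : J) (g : P →ₗ[R] D.obj j), (c.ι.app j).hom ∘ₗ g = f := by
  classical
  obtain ⟨n, π, hπ⟩ := Module.Finite.exists_fin' R P
  obtain ⟨S, hS⟩ := Module.FinitePresentation.fg_ker π hπ
  obtain ⟨j, x, hx⟩ := exists_finite_family_rep hc fun i => f (π (Pi.basisFun R (Fin n) i))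
  set h : (Fin n → R) →ₗ[R] D.obj j := (Pi.basisFun R (Fin n)).constr ℕ x with hh
  have hcomp : (c.ι.app j).hom ∘ₗ h = f ∘ₗ π :=
    (Pi.basisFun R (Fin n)).ext fun i => by
      rw [LinearMap.comp_apply, hh, Module.Basis.constr_basis]
      exact hx i
  obtain ⟨k, a, ha⟩ := exists_map_eq_zero_of_finset hc (S.image h) fun y hy => by
    obtain ⟨s, hs, rfl⟩ := Finset.mem_image.mp hy
    have hs' : π s = 0 := LinearMap.mem_ker.mp (hS ▸ Submodule.subset_span hs)
    exact (LinearMap.congr_fun hcomp s).trans (by rw [LinearMap.comp_apply, hs', map_zero])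
  have hker : LinearMap.ker π ≤ LinearMap.ker ((D.map a).hom ∘ₗ h) := by
    rw [← hS, Submodule.span_le]
    exact fun s hs => ha (h s) (Finset.mem_image_of_mem h hs)
  refine ⟨k, (LinearMap.ker π).liftQ _ hker ∘ₗ
    (π.quotKerEquivOfSurjective hπ).symm.toLinearMap, ?_⟩
  ext p
  obtain ⟨y, rfl⟩ := hπ p
  have hy : (π.quotKerEquivOfSurjective hπ).symm (π y) = Submodule.Quotient.mk y := by
    rw [LinearEquiv.symm_apply_eq]
    rfl
  have hw : (c.ι.app k) (D.map a (h y)) = c.ι.app j (h y) := by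
    rw [← ConcreteCategory.comp_apply, c.w]
  simp only [LinearMap.comp_apply, LinearEquiv.coe_coe, hy, Submodule.liftQ_apply]
  exact hw.trans (LinearMap.congr_fun hcomp y)

end

/-- A class of modules cut out by `Hom`-vanishing from finitely presented modules is closed under
direct limits. -/
theorem IsTCGTorsionPair.closedUnderDirectLimits {T F : ModuleCat.{u} R → Prop}
    (h : IsTCGTorsionPair R T F) : ClosedUnderDirectLimits R F := by
  obtain ⟨Λ, Tfam, hfp, _, hF⟩ := h
  intro J _ _ D c hc hD
  refine (hF _).mpr fun l f => ?_
  have := hfp l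
  obtain ⟨j, g, rfl⟩ := exists_factorization_of_finitePresentation hc f
  rw [(hF _).mp (hD j) l g, LinearMap.comp_zero]

section

variable {R}
variable {T F : ModuleCat.{u} R → Prop}

/-- A class closed under isomorphisms and direct limits contains a module as soon as it contains
all of its finitely generated submodules. -/
theorem ClosedUnderDirectLimits.of_fg_submodules (hF : ClosedUnderDirectLimits R F)
    (hiso : ∀ {M N : ModuleCat.{u} R}, (M ≅ N) → F M → F N) (M : ModuleCat.{u} R)
    (h : ∀ N : Submodule R M, N.FG → F (ModuleCat.of R N)) : F M := by
  classical
  have : Nonempty {N : Submodule R M // N.FG} := ⟨⟨⊥, Submodule.fg_bot⟩⟩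
  exact hiso (Module.fgSystem.equiv R M).toModuleIso <|
    hF _ _ _ (ModuleCat.directLimitIsColimit _ (Module.fgSystem R M)) fun N => h N.1 N.2

theorem ModTorsionPair.torsionfree_of_hom_eq_zero (htp : ModTorsionPair R T F)
    (M : ModuleCat.{u} R)
    (h : ∀ t : Submodule R M, T (ModuleCat.of R t) → t = ⊥) : F M := by
  obtain ⟨t, ht, hq⟩ := htp.exists_torsion_submodule M
  exact htp.iso_closed_torsionfree (Submodule.quotEquivOfEqBot t (h t ht)).toModuleIso hq

/-- Over a left Noetherian ring, a torsion pair of finite type is generated by finitely presented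
torsion modules. -/
theorem ModTorsionPair.isTCG_of_closedUnderDirectLimits [IsNoetherianRing R]
    (htp : ModTorsionPair R T F) (hF : ClosedUnderDirectLimits R F) :
    IsTCGTorsionPair R T F := by
  refine ⟨{p : Σ n : ℕ, Submodule R (Fin n → R) // T (ModuleCat.of R ((Fin p.1 → R) ⧸ p.2))},
    fun p => ModuleCat.of R ((Fin p.1.1 → R) ⧸ p.1.2),
    fun p => Module.finitePresentation_of_finite R _, fun p => p.2, fun M =>
    ⟨fun hM p f => htp.hom_eq_zero p.2 hM f, fun h => ?_⟩⟩
  refine hF.of_fg_submodules htp.iso_closed_torsionfree M fun N hN =>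
    htp.torsionfree_of_hom_eq_zero _ fun t ht => ?_
  have : Module.Finite R N := Module.Finite.iff_fg.mpr hN
  obtain ⟨n, π, hπ⟩ := Module.Finite.exists_fin' R t
  let e := π.quotKerEquivOfSurjective hπ
  have hz : (N.subtype ∘ₗ t.subtype) ∘ₗ e.toLinearMap = 0 :=
    h ⟨⟨n, LinearMap.ker π⟩, htp.iso_closed_torsion e.symm.toModuleIso ht⟩ _
  refine (Submodule.eq_bot_iff t).mpr fun x hx => Subtype.ext ?_
  simpa using LinearMap.congr_fun hz (e.symm ⟨x, hx⟩)

end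

/-- **Theorem.** Over a left Noetherian ring, a torsion pair is tCG if and only if it
is of finite type. -/
theorem noetherian_isTCG_iff_finite_type [IsNoetherianRing R]
    (T F : ModuleCat.{u} R → Prop) (htp : ModTorsionPair R T F) :
    IsTCGTorsionPair R T F ↔ ClosedUnderDirectLimits R F :=
  ⟨fun h => h.closedUnderDirectLimits, htp.isTCG_of_closedUnderDirectLimits⟩
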